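/- Let Ω⁺ ⊂ ℝ³ be a bounded open set with Lipschitz boundary, let Ω⁻ be a minimizer of the unconstrained problem, and let φ be the associated potential. Then the set {φ > 0} \ closure(Ω⁺) differs from Ω⁻ by a set of Lebesgue measure zero; in particular the minimizer has a representative that is an open set. If moreover Ω⁺ satisfies an interior ball condition (every boundary point is touched from inside by an open ball contained in Ω⁺), then φ > 0 on the closure of Ω⁺. -/

import Mathlib

open MeasureTheory Real
open scoped RealInnerProductSpace

noncomputable section

abbrev E3 := EuclideanSpace ℝ (Fin 3)

/-- The Coulomb kernel in ℝ³. -/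
def coul (x y : E3) : ℝ := 1 / (4 * π * ‖x - y‖)

/-- The Coulomb energy `E(Ω⁻)`. -/
def energy (Ωp Ωm : Set E3) : ℝ :=
  (∫ x in Ωp, ∫ y in Ωp, coul x y) + (∫ x in Ωm, ∫ y in Ωm, coul x y)
    - 2 * ∫ x in Ωp, ∫ y in Ωm, coul x y

/-- Admissible configurations for the unconstrained problem. -/
def Adm (Ωp Ωm : Set E3) : Prop :=
  MeasurableSet Ωm ∧ volume (Ωp ∩ Ωm) = 0 ∧ volume Ωm < ⊤

/-- The potential `φ` generated by the charges `χ_{Ω⁺} − χ_{Ω⁻}`. -/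
def potential (Ωp Ωm : Set E3) (x : E3) : ℝ :=
  ∫ y, (Set.indicator Ωp (fun _ => (1:ℝ)) y - Set.indicator Ωm (fun _ => (1:ℝ)) y) * coul x y

/-- A bounded open set has Lipschitz boundary if near each boundary point, after
choosing a unit direction `ν`, the set is the region above the graph of a
Lipschitz function over the hyperplane orthogonal to `ν`. -/
def HasLipschitzBoundary (Ω : Set E3) : Prop :=
  ∀ x ∈ frontier Ω, ∃ (ν : E3) (ψ : E3 → ℝ) (K : NNReal) (r : ℝ),
    ‖ν‖ = 1 ∧ LipschitzWith K ψ ∧ 0 < r ∧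
    ∀ (v : E3) (t : ℝ), ⟪v, ν⟫ = 0 → x + v + t • ν ∈ Metric.ball x r →
      (x + v + t • ν ∈ Ω ↔ ψ v < t)


/-- The interior ball condition: every boundary point is touched from inside by
an open ball contained in `Ω`. -/
def InteriorBallCondition (Ω : Set E3) : Prop :=
  ∀ x ∈ frontier Ω, ∃ (c : E3) (ρ : ℝ), 0 < ρ ∧ Metric.ball c ρ ⊆ Ω ∧ dist x c = ρ

section Helpers

open Set Filter Topology

/-- The heat kernel in ℝ³, normalised so that `∂ₜ p = Δ p`. -/
def heatKernel (t : ℝ) (x : E3) : ℝ :=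
  (4 * π * t) ^ (-(3 / 2) : ℝ) * Real.exp (-‖x‖ ^ 2 / (4 * t))

lemma heatKernel_nonneg {t : ℝ} (ht : 0 ≤ t) (x : E3) : 0 ≤ heatKernel t x := by
  unfold heatKernel; positivity

lemma heatKernel_neg (t : ℝ) (x : E3) : heatKernel t (-x) = heatKernel t x := by
  simp [heatKernel]

lemma heatKernel_le {t : ℝ} (ht : 0 < t) (x : E3) :
    heatKernel t x ≤ (4 * π * t) ^ (-(3 / 2) : ℝ) := by
  unfold heatKernel
  refine mul_le_of_le_one_right (by positivity) (Real.exp_le_one_iff.2 ?_)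
  rw [neg_div]
  exact neg_nonpos.2 (by positivity)

lemma measurable_heatKernel : Measurable fun q : ℝ × E3 => heatKernel q.1 q.2 := by
  unfold heatKernel; fun_prop

lemma continuous_heatKernel (t : ℝ) : Continuous (heatKernel t) := by
  unfold heatKernel; fun_prop

lemma gaussian_const {t : ℝ} (ht : 0 < t) :
    (4 * π * t) ^ (-(3 / 2) : ℝ) * (π / (1 / (4 * t))) ^ ((3 : ℝ) / 2) = 1 := by
  rw [show π / (1 / (4 * t)) = 4 * π * t by field_simp, ← Real.rpow_add (by positivity)]
  norm_num

lemma integral_exp_neg_mul_sq_norm {b : ℝ} (hb : 0 < b) :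
    ∫ v : E3, Real.exp (-b * ‖v‖ ^ 2) = (π / b) ^ ((3 : ℝ) / 2) := by
  have := GaussianFourier.integral_rexp_neg_mul_sq_norm (V := E3) hb
  simpa using this

lemma heatKernel_eq {t : ℝ} (ht : 0 < t) (x : E3) :
    heatKernel t x = (4 * π * t) ^ (-(3 / 2) : ℝ) * Real.exp (-(1 / (4 * t)) * ‖x‖ ^ 2) := by
  unfold heatKernel
  congr 2
  field_simp

lemma integral_heatKernel {t : ℝ} (ht : 0 < t) : ∫ z, heatKernel t z = 1 := by
  simp_rw [heatKernel_eq ht]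
  rw [integral_const_mul, integral_exp_neg_mul_sq_norm (by positivity), gaussian_const ht]

lemma integrable_heatKernel {t : ℝ} (ht : 0 < t) : Integrable (heatKernel t) :=
  .of_integral_ne_zero (by rw [integral_heatKernel ht]; exact one_ne_zero)

lemma integrable_heatKernel_sub {t : ℝ} (ht : 0 < t) (x : E3) :
    Integrable fun z => heatKernel t (x - z) :=
  (integrable_heatKernel ht).comp_sub_left x

lemma integral_heatKernel_sub {t : ℝ} (ht : 0 < t) (x : E3) :
    ∫ z, heatKernel t (x - z) = 1 := by
  rw [integral_sub_left_eq_self (heatKernel t), integral_heatKernel ht]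

lemma lintegral_heatKernel_sub {t : ℝ} (ht : 0 < t) (x : E3) :
    ∫⁻ z, ENNReal.ofReal (heatKernel t (x - z)) = 1 := by
  rw [← ofReal_integral_eq_lintegral_ofReal (integrable_heatKernel_sub ht x)
    (.of_forall fun z => heatKernel_nonneg ht.le _), integral_heatKernel_sub ht,
    ENNReal.ofReal_one]

lemma heatKernel_mul_heatKernel {s t : ℝ} (hs : 0 < s) (ht : 0 < t) (w z : E3) :
    heatKernel s (w - z) * heatKernel t z =
      heatKernel (s + t) w * heatKernel (s * t / (s + t)) (z - (t / (s + t)) • w) := by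
  have hst : 0 < s + t := add_pos hs ht
  unfold heatKernel
  rw [mul_mul_mul_comm ((4 * π * s) ^ _), mul_mul_mul_comm ((4 * π * (s + t)) ^ _), ← Real.mul_rpow (by positivity) (by positivity),
    ← Real.mul_rpow (by positivity) (by positivity), ← Real.exp_add, ← Real.exp_add]
  congr 2
  · field_simp
  · rw [norm_sub_sq_real, norm_sub_sq_real, norm_smul, inner_smul_right, Real.norm_eq_abs,
      abs_of_pos (by positivity), real_inner_comm]
    field_simp
    ring

lemma integral_heatKernel_mul_heatKernel {s t : ℝ} (hs : 0 < s) (ht : 0 < t) (x y : E3) :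
    ∫ z, heatKernel s (x - z) * heatKernel t (z - y) = heatKernel (s + t) (x - y) := by
  have hst : 0 < s * t / (s + t) := by positivity
  rw [← integral_add_right_eq_self _ y]
  have h : ∀ z, heatKernel s (x - (z + y)) * heatKernel t (z + y - y) =
      heatKernel (s + t) (x - y) *
        heatKernel (s * t / (s + t)) (z - (t / (s + t)) • (x - y)) := fun z => by
    rw [← heatKernel_mul_heatKernel hs ht, add_sub_cancel_right]
    congr 2
    abel
  simp_rw [h]
  rw [integral_const_mul, integral_sub_right_eq_self (heatKernel _), integral_heatKernel hst,
    mul_one]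

lemma lintegral_heatKernel_mul_heatKernel {s t : ℝ} (hs : 0 < s) (ht : 0 < t) (x y : E3) :
    ∫⁻ z, ENNReal.ofReal (heatKernel s (x - z)) * ENNReal.ofReal (heatKernel t (z - y)) =
      ENNReal.ofReal (heatKernel (s + t) (x - y)) := by
  have hint : Integrable fun z => heatKernel s (x - z) * heatKernel t (z - y) := by
    refine (integrable_heatKernel_sub hs x).mul_bdd (c := (4 * π * t) ^ (-(3 / 2) : ℝ)) ?_ ?_
    · exact ((continuous_heatKernel t).comp (continuous_id.sub continuous_const)).aestronglyMeasurable
    · refine .of_forall fun z => ?_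
      rw [Real.norm_of_nonneg (heatKernel_nonneg ht.le _)]
      exact heatKernel_le ht _
  rw [← integral_heatKernel_mul_heatKernel hs ht, ofReal_integral_eq_lintegral_ofReal hint
    (.of_forall fun z => mul_nonneg (heatKernel_nonneg hs.le _) (heatKernel_nonneg ht.le _))]
  exact lintegral_congr fun z => (ENNReal.ofReal_mul (heatKernel_nonneg hs.le _)).symm

lemma heatKernel_mul_exp_le {t : ℝ} (ht : 0 < t) (x : E3) :
    heatKernel t x * Real.exp (‖x‖ ^ 2 / (8 * t)) ≤ 3 * heatKernel (2 * t) x := by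
  have h2 : (2 : ℝ) ^ ((3 : ℝ) / 2) ≤ 3 := by
    refine (Real.rpow_le_rpow_iff (z := 2) (by positivity) (by norm_num) (by norm_num)).1 ?_
    rw [← Real.rpow_mul (by norm_num)]
    norm_num
  have h3 : (4 * π * t) ^ (-(3 / 2) : ℝ) =
      (2 : ℝ) ^ ((3 : ℝ) / 2) * (4 * π * (2 * t)) ^ (-(3 / 2) : ℝ) := by
    rw [show 4 * π * (2 * t) = 2 * (4 * π * t) by ring, Real.mul_rpow (x := 2) (by norm_num) (by positivity),
      ← mul_assoc, ← Real.rpow_add (by norm_num)]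
    norm_num
  have h4 : heatKernel t x * Real.exp (‖x‖ ^ 2 / (8 * t)) =
      (2 : ℝ) ^ ((3 : ℝ) / 2) * heatKernel (2 * t) x := by
    unfold heatKernel
    rw [mul_assoc, ← Real.exp_add, h3, mul_assoc]
    congr 4
    field_simp
    ring
  rw [h4]
  exact mul_le_mul_of_nonneg_right h2 (heatKernel_nonneg (by positivity) _)

lemma heatKernel_mul_sq_le {t : ℝ} (ht : 0 < t) (x : E3) :
    heatKernel t x * ‖x‖ ^ 2 ≤ 24 * t * heatKernel (2 * t) x := by
  have h1 : ‖x‖ ^ 2 ≤ 8 * t * Real.exp (‖x‖ ^ 2 / (8 * t)) := by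
    have := Real.add_one_le_exp (‖x‖ ^ 2 / (8 * t))
    rw [← div_le_iff₀' (by positivity)]
    linarith
  have h2 := heatKernel_mul_exp_le ht x
  have h0 := heatKernel_nonneg ht.le x
  nlinarith [mul_le_mul_of_nonneg_left h1 h0]

lemma integral_heatKernel_time {x : E3} (hx : x ≠ 0) :
    ∫ t in Ioi (0 : ℝ), heatKernel t x = 1 / (4 * π * ‖x‖) := by
  have hn : 0 < ‖x‖ := norm_pos_iff.2 hx
  have h1 := integral_comp_rpow_Ioi
    (fun y : ℝ => y ^ ((1 / 2 : ℝ) - 1) * Real.exp (-(‖x‖ ^ 2 / 4 * y))) (p := -1) (by norm_num)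
  rw [Real.integral_rpow_mul_exp_neg_mul_Ioi (by norm_num) (by positivity),
    Real.Gamma_one_half_eq] at h1
  have h2 : ∀ t ∈ Ioi (0 : ℝ), heatKernel t x = (4 * π) ^ (-(3 / 2) : ℝ) *
      ((|(-1 : ℝ)| * t ^ ((-1 : ℝ) - 1)) •
        ((t ^ (-1 : ℝ)) ^ ((1 / 2 : ℝ) - 1) * Real.exp (-(‖x‖ ^ 2 / 4 * t ^ (-1 : ℝ))))) := by
    intro t ht
    have ht : 0 < t := ht
    unfold heatKernel
    rw [Real.mul_rpow (by positivity) ht.le, mul_assoc, smul_eq_mul, ← mul_assoc (_ * _),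
      ← Real.rpow_mul ht.le, mul_assoc (|_|), ← Real.rpow_add ht, Real.rpow_neg_one]
    norm_num
    field_simp
    simp
  rw [setIntegral_congr_fun measurableSet_Ioi h2, integral_const_mul, h1,
    ← Real.sqrt_eq_rpow, show 1 / (‖x‖ ^ 2 / 4) = (2 / ‖x‖) ^ 2 by field_simp; norm_num,
    Real.sqrt_sq (by positivity), Real.rpow_neg (by positivity),
    show (3 / 2 : ℝ) = 1 + 1 / 2 by norm_num, Real.rpow_add (by positivity), ← Real.sqrt_eq_rpow,
    Real.rpow_one, show 4 * π = 2 ^ 2 * π by norm_num, Real.sqrt_mul (by positivity),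
    Real.sqrt_sq (by norm_num)]
  have := Real.sqrt_pos.2 Real.pi_pos
  field_simp

lemma lintegral_heatKernel_time {x : E3} (hx : x ≠ 0) :
    ∫⁻ t in Ioi (0 : ℝ), ENNReal.ofReal (heatKernel t x) = ENNReal.ofReal (1 / (4 * π * ‖x‖)) := by
  have hn : 0 < ‖x‖ := norm_pos_iff.2 hx
  rw [← integral_heatKernel_time hx, ofReal_integral_eq_lintegral_ofReal]
  · refine .of_integral_ne_zero ?_
    rw [integral_heatKernel_time hx]
    positivity
  · filter_upwards [ae_restrict_mem measurableSet_Ioi] with t ht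
    exact heatKernel_nonneg (le_of_lt ht) _

/-- The heat semigroup applied to the indicator of `A`. -/
def heatMass (t : ℝ) (A : Set E3) (x : E3) : ENNReal :=
  ∫⁻ y in A, ENNReal.ofReal (heatKernel t (x - y))

/-- The time integral over `(0, s]` of the heat semigroup applied to the indicator of `A`. -/
def heatMassInt (s : ℝ) (A : Set E3) (x : E3) : ENNReal :=
  ∫⁻ t in Ioc 0 s, heatMass t A x

/-- The Newton potential of the indicator of `A`. -/
def newton (A : Set E3) (x : E3) : ENNReal :=
  ∫⁻ y in A, ENNReal.ofReal (coul x y)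

lemma measurable_heatKernel_sub :
    Measurable fun q : (ℝ × E3) × E3 => ENNReal.ofReal (heatKernel q.1.1 (q.1.2 - q.2)) :=
  (measurable_heatKernel.comp (f := fun q : (ℝ × E3) × E3 => (q.1.1, q.1.2 - q.2))
    (by fun_prop)).ennreal_ofReal

lemma measurable_heatMass (A : Set E3) : Measurable fun q : ℝ × E3 => heatMass q.1 A q.2 :=
  measurable_heatKernel_sub.lintegral_prod_right' (ν := volume.restrict A)

lemma measurable_coul : Measurable fun q : E3 × E3 => coul q.1 q.2 := by
  unfold coul; fun_prop

lemma coul_nonneg (x y : E3) : 0 ≤ coul x y := by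
  unfold coul; positivity

lemma coul_comm (x y : E3) : coul x y = coul y x := by
  unfold coul; rw [norm_sub_rev]

lemma measurable_newton (A : Set E3) : Measurable (newton A) :=
  measurable_coul.ennreal_ofReal.lintegral_prod_right' (ν := volume.restrict A)

lemma heatMass_le_one {t : ℝ} (ht : 0 < t) (A : Set E3) (x : E3) : heatMass t A x ≤ 1 :=
  (setLIntegral_le_lintegral _ _).trans_eq (lintegral_heatKernel_sub ht x)

lemma heatMassInt_le_mul {s : ℝ} {A : Set E3} {x : E3} {c : ENNReal}
    (h : ∀ t ∈ Ioc 0 s, heatMass t A x ≤ c) : heatMassInt s A x ≤ c * ENNReal.ofReal s := by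
  refine (setLIntegral_mono measurable_const h).trans_eq ?_
  simp

lemma heatMassInt_le {s : ℝ} (A : Set E3) (x : E3) :
    heatMassInt s A x ≤ ENNReal.ofReal s := by
  simpa using heatMassInt_le_mul (c := 1) fun t ht => heatMass_le_one ht.1 A x

lemma heatMassInt_add_compl {s : ℝ} {A : Set E3} (hA : MeasurableSet A) (x : E3) :
    heatMassInt s A x + heatMassInt s Aᶜ x = ENNReal.ofReal s := by
  have hm : Measurable fun t => heatMass t A x :=
    (measurable_heatMass A).comp measurable_prodMk_right
  unfold heatMassInt
  rw [← lintegral_add_left hm]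
  trans ∫⁻ t in Ioc 0 s, 1
  · refine setLIntegral_congr_fun measurableSet_Ioc fun t ht => ?_
    exact (lintegral_add_compl _ hA).trans (lintegral_heatKernel_sub ht.1 x)
  · simp

lemma heatMass_mono {A B : Set E3} (h : A ≤ᵐ[volume] B) (t : ℝ) (x : E3) :
    heatMass t A x ≤ heatMass t B x :=
  lintegral_mono' (Measure.restrict_mono_ae h) le_rfl

lemma heatMassInt_mono {A B : Set E3} (h : A ≤ᵐ[volume] B) (s : ℝ) (x : E3) :
    heatMassInt s A x ≤ heatMassInt s B x :=
  lintegral_mono fun t => heatMass_mono h t x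

lemma heatMass_le_of_inter_ball {t r : ℝ} (ht : 0 < t) (hr : 0 < r) {A : Set E3} {x : E3}
    (h : volume (A ∩ Metric.ball x r) = 0) :
    heatMass t A x ≤ ENNReal.ofReal (24 * t / r ^ 2) := by
  have hae : ∀ᵐ y ∂volume.restrict A, ENNReal.ofReal (heatKernel t (x - y)) ≤
      ENNReal.ofReal (24 * t / r ^ 2) * ENNReal.ofReal (heatKernel (2 * t) (x - y)) := by
    rw [ae_iff, ← nonpos_iff_eq_zero, ← h, inter_comm]
    refine (measure_mono ?_).trans (Measure.restrict_apply Metric.isOpen_ball.measurableSet).le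
    intro y hy
    by_contra hyr
    refine hy ?_
    rw [← ENNReal.ofReal_mul (by positivity)]
    refine ENNReal.ofReal_le_ofReal ?_
    have h1 : r ≤ ‖x - y‖ := by
      rw [Metric.mem_ball, not_lt, dist_comm, dist_eq_norm] at hyr
      exact hyr
    rw [div_mul_eq_mul_div, le_div_iff₀ (by positivity)]
    refine le_trans ?_ (heatKernel_mul_sq_le ht (x - y))
    exact mul_le_mul_of_nonneg_left (by gcongr) (heatKernel_nonneg ht.le _)
  calc heatMass t A x ≤ _ := lintegral_mono_ae hae
    _ = ENNReal.ofReal (24 * t / r ^ 2) * heatMass (2 * t) A x :=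
        lintegral_const_mul' _ _ ENNReal.ofReal_ne_top
    _ ≤ ENNReal.ofReal (24 * t / r ^ 2) * 1 := by
        gcongr; exact heatMass_le_one (by positivity) A x
    _ = _ := mul_one _

lemma heatMassInt_le_of_inter_ball {s r : ℝ} (hs : 0 < s) (hr : 0 < r) {A : Set E3} {x : E3}
    (h : volume (A ∩ Metric.ball x r) = 0) :
    heatMassInt s A x ≤ ENNReal.ofReal (24 * s / r ^ 2 * s) := by
  rw [ENNReal.ofReal_mul (by positivity)]
  refine heatMassInt_le_mul fun t ht => (heatMass_le_of_inter_ball ht.1 hr h).trans ?_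
  refine ENNReal.ofReal_le_ofReal ?_
  gcongr
  exact ht.2

lemma newton_eq_lintegral_heatMass (A : Set E3) (x : E3) :
    newton A x = ∫⁻ t in Ioi (0 : ℝ), heatMass t A x := by
  have h : ∀ᵐ y ∂volume.restrict A, ENNReal.ofReal (coul x y) =
      ∫⁻ t in Ioi (0 : ℝ), ENNReal.ofReal (heatKernel t (x - y)) := by
    have : ∀ᵐ y : E3 ∂volume, y ≠ x := by
      simp [ae_iff]
    filter_upwards [ae_restrict_of_ae this] with y hy
    rw [lintegral_heatKernel_time (sub_ne_zero.2 hy.symm), coul]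
  unfold newton heatMass
  rw [lintegral_congr_ae h, lintegral_lintegral_swap]
  refine Measurable.aemeasurable ?_
  exact measurable_heatKernel_sub.comp (f := fun q : E3 × ℝ => ((q.2, x), q.1)) (by fun_prop)

lemma lintegral_heatKernel_mul_heatMass {s t : ℝ} (hs : 0 < s) (ht : 0 < t) (A : Set E3)
    (x : E3) :
    ∫⁻ z, ENNReal.ofReal (heatKernel s (x - z)) * heatMass t A z = heatMass (s + t) A x := by
  unfold heatMass
  simp_rw [← lintegral_heatKernel_mul_heatKernel hs ht]
  rw [lintegral_lintegral_swap]
  · refine lintegral_congr fun z => ?_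
    rw [lintegral_const_mul' _ _ ENNReal.ofReal_ne_top]
  · refine Measurable.aemeasurable ?_
    exact (measurable_heatKernel_sub.comp (f := fun q : E3 × E3 => ((s, x), q.2))
      (by fun_prop)).mul (measurable_heatKernel_sub.comp (f := fun q : E3 × E3 => ((t, q.2), q.1))
      (by fun_prop))

lemma lintegral_heatKernel_mul_newton {s : ℝ} (hs : 0 < s) (A : Set E3) (x : E3) :
    ∫⁻ z, ENNReal.ofReal (heatKernel s (x - z)) * newton A z =
      ∫⁻ t in Ioi s, heatMass t A x := by
  have h1 : ∀ z, ENNReal.ofReal (heatKernel s (x - z)) * newton A z =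
      ∫⁻ t in Ioi (0 : ℝ), ENNReal.ofReal (heatKernel s (x - z)) * heatMass t A z := fun z => by
    rw [newton_eq_lintegral_heatMass, lintegral_const_mul' _ _ ENNReal.ofReal_ne_top]
  simp_rw [h1]
  rw [lintegral_lintegral_swap]
  · rw [setLIntegral_congr_fun measurableSet_Ioi
      fun t (ht : 0 < t) => lintegral_heatKernel_mul_heatMass hs ht A x]
    have := (measurePreserving_add_left volume s).setLIntegral_comp_preimage_emb
      (measurableEmbedding_addLeft s) (fun t => heatMass t A x) (Ioi s)
    simpa using this
  · refine Measurable.aemeasurable ?_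
    exact (measurable_heatKernel_sub.comp (f := fun q : E3 × ℝ => ((s, x), q.1))
      (by fun_prop)).mul ((measurable_heatMass A).comp (f := fun q : E3 × ℝ => (q.2, q.1))
      (by fun_prop))

lemma newton_eq {s : ℝ} (hs : 0 < s) (A : Set E3) (x : E3) :
    newton A x = heatMassInt s A x +
      ∫⁻ z, ENNReal.ofReal (heatKernel s (x - z)) * newton A z := by
  rw [lintegral_heatKernel_mul_newton hs, newton_eq_lintegral_heatMass, heatMassInt,
    ← Ioc_union_Ioi_eq_Ioi hs.le, lintegral_union measurableSet_Ioi (Ioc_disjoint_Ioi le_rfl)]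

lemma integrableOn_heatKernel_bound {s : ℝ} (hs : 0 < s) :
    IntegrableOn (fun t : ℝ => (4 * π * t) ^ (-(3 / 2) : ℝ)) (Ioi s) := by
  have h := (integrableOn_Ioi_rpow_of_lt (a := -(3 / 2)) (by norm_num) hs).const_mul
    ((4 * π) ^ (-(3 / 2) : ℝ))
  refine IntegrableOn.congr_fun h (fun t ht => ?_) measurableSet_Ioi
  exact (Real.mul_rpow (by positivity) (hs.le.trans (le_of_lt ht))).symm

/-- Mass bound for `∫ₛ^∞ pₜ dt`. -/
def farConst (s : ℝ) : ℝ := ∫ t in Ioi s, (4 * π * t) ^ (-(3 / 2) : ℝ)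

lemma farConst_nonneg {s : ℝ} (hs : 0 < s) : 0 ≤ farConst s :=
  setIntegral_nonneg measurableSet_Ioi fun t ht => by
    have : 0 < t := hs.trans ht
    positivity

lemma lintegral_heatMass_Ioi_le {s : ℝ} (hs : 0 < s) (A : Set E3) (x : E3) :
    ∫⁻ t in Ioi s, heatMass t A x ≤ ENNReal.ofReal (farConst s) * volume A := by
  have hpos : ∀ t ∈ Ioi s, 0 ≤ (4 * π * t) ^ (-(3 / 2) : ℝ) := fun t ht => by
    have : 0 < t := hs.trans ht
    positivity
  rw [farConst, ofReal_integral_eq_lintegral_ofReal (integrableOn_heatKernel_bound hs)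
    ((ae_restrict_mem measurableSet_Ioi).mono hpos), ← lintegral_mul_const _ (by fun_prop)]
  refine setLIntegral_mono (by fun_prop) fun t ht => ?_
  refine (lintegral_mono fun y => ENNReal.ofReal_le_ofReal
    (heatKernel_le (hs.trans ht) (x - y))).trans_eq ?_
  simp

lemma newton_le {s : ℝ} (hs : 0 < s) (A : Set E3) (x : E3) :
    newton A x ≤ ENNReal.ofReal s + ENNReal.ofReal (farConst s) * volume A := by
  rw [newton_eq hs, lintegral_heatKernel_mul_newton hs]
  exact add_le_add (heatMassInt_le A x) (lintegral_heatMass_Ioi_le hs A x)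

lemma newton_ne_top {A : Set E3} (hA : volume A ≠ ⊤) (x : E3) : newton A x ≠ ⊤ :=
  ((newton_le one_pos A x).trans_lt (ENNReal.add_lt_top.2
    ⟨ENNReal.ofReal_lt_top, ENNReal.mul_lt_top ENNReal.ofReal_lt_top hA.lt_top⟩)).ne

/-- The real-valued Newton potential of `A`. -/
def newtonR (A : Set E3) (x : E3) : ℝ := ∫ y in A, coul x y

lemma newtonR_eq_toReal (A : Set E3) (x : E3) : newtonR A x = (newton A x).toReal :=
  integral_eq_lintegral_of_nonneg_ae (.of_forall fun y => coul_nonneg x y)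
    (measurable_coul.comp measurable_prodMk_left).aestronglyMeasurable

lemma newtonR_nonneg (A : Set E3) (x : E3) : 0 ≤ newtonR A x := by
  rw [newtonR_eq_toReal]; exact ENNReal.toReal_nonneg

lemma ofReal_newtonR {A : Set E3} (hA : volume A ≠ ⊤) (x : E3) :
    ENNReal.ofReal (newtonR A x) = newton A x := by
  rw [newtonR_eq_toReal, ENNReal.ofReal_toReal (newton_ne_top hA x)]

lemma newtonR_le {s : ℝ} (hs : 0 < s) {A : Set E3} (hA : volume A ≠ ⊤) (x : E3) :
    newtonR A x ≤ s + farConst s * volume.real A := by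
  have h := ENNReal.toReal_mono (by finiteness) (newton_le hs A x)
  rwa [← newtonR_eq_toReal, ENNReal.toReal_add (by finiteness) (by finiteness),
    ENNReal.toReal_mul, ENNReal.toReal_ofReal hs.le,
    ENNReal.toReal_ofReal (farConst_nonneg hs)] at h

lemma integrableOn_coul {A : Set E3} (hA : volume A ≠ ⊤) (x : E3) : IntegrableOn (coul x) A := by
  refine ⟨(measurable_coul.comp measurable_prodMk_left).aestronglyMeasurable, ?_⟩
  rw [hasFiniteIntegral_iff_ofReal (.of_forall fun y => coul_nonneg x y)]
  exact (newton_ne_top hA x).lt_top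

lemma measurable_newtonR (A : Set E3) : Measurable (newtonR A) := by
  simp_rw [funext (newtonR_eq_toReal A)]
  exact (measurable_newton A).ennreal_toReal

/-- The part `∫ₛ^∞ pₜ * χ_A dt` of the Newton potential. -/
def farPart (s : ℝ) (A : Set E3) (x : E3) : ℝ :=
  ∫ q : ℝ × E3, heatKernel q.1 (x - q.2) ∂((volume.restrict (Ioi s)).prod (volume.restrict A))

section FarPart

variable {s : ℝ} {A : Set E3}

lemma ae_prod_mem_Ioi :
    ∀ᵐ q : ℝ × E3 ∂((volume.restrict (Ioi s)).prod (volume.restrict A)), s < q.1 :=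
  Measure.quasiMeasurePreserving_fst.ae (ae_restrict_mem measurableSet_Ioi)

lemma measurable_heatKernel_sub_real (x : E3) :
    Measurable fun q : ℝ × E3 => heatKernel q.1 (x - q.2) :=
  measurable_heatKernel.comp (f := fun q : ℝ × E3 => (q.1, x - q.2)) (by fun_prop)

lemma farPart_bound (hs : 0 < s) (x : E3) :
    ∀ᵐ q : ℝ × E3 ∂((volume.restrict (Ioi s)).prod (volume.restrict A)),
      ‖heatKernel q.1 (x - q.2)‖ ≤ (4 * π * q.1) ^ (-(3 / 2) : ℝ) := by
  filter_upwards [ae_prod_mem_Ioi] with q hq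
  rw [Real.norm_of_nonneg (heatKernel_nonneg (hs.trans hq).le _)]
  exact heatKernel_le (hs.trans hq) _

lemma integrable_farPart_bound (hs : 0 < s) (hA : volume A ≠ ⊤) :
    Integrable (fun q : ℝ × E3 => (4 * π * q.1) ^ (-(3 / 2) : ℝ))
      ((volume.restrict (Ioi s)).prod (volume.restrict A)) := by
  have : IsFiniteMeasure (volume.restrict A) := isFiniteMeasure_restrict.2 hA
  exact Integrable.comp_fst (integrableOn_heatKernel_bound hs) (volume.restrict A)

lemma continuous_farPart (hs : 0 < s) (hA : volume A ≠ ⊤) : Continuous (farPart s A) :=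
  continuous_of_dominated (fun x => (measurable_heatKernel_sub_real x).aestronglyMeasurable)
    (farPart_bound hs) (integrable_farPart_bound hs hA)
    (.of_forall fun q => (continuous_heatKernel q.1).comp (continuous_id.sub continuous_const))

lemma tendsto_heatKernel_cocompact {t : ℝ} (ht : 0 < t) :
    Tendsto (heatKernel t) (cocompact E3) (𝓝 0) := by
  have h1 : Tendsto (fun x : E3 => ‖x‖ ^ 2 / (4 * t)) (cocompact E3) atTop :=
    ((tendsto_pow_atTop two_ne_zero).comp tendsto_norm_cocompact_atTop).atTop_div_const
      (by positivity)
  have h2 := (Real.tendsto_exp_neg_atTop_nhds_zero.comp h1).const_mul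
    ((4 * π * t) ^ (-(3 / 2) : ℝ))
  rw [mul_zero] at h2
  refine h2.congr fun x => ?_
  simp [heatKernel, neg_div]

lemma tendsto_farPart (hs : 0 < s) (hA : volume A ≠ ⊤) :
    Tendsto (farPart s A) (cocompact E3) (𝓝 0) := by
  have : (cocompact E3).IsCountablyGenerated := by
    rw [← comap_dist_left_atTop_eq_cocompact (0 : E3)]
    infer_instance
  have h := tendsto_integral_filter_of_dominated_convergence (l := cocompact E3)
    (F := fun (x : E3) (q : ℝ × E3) => heatKernel q.1 (x - q.2)) (f := fun _ => 0)
    (μ := (volume.restrict (Ioi s)).prod (volume.restrict A)) _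
    (.of_forall fun x => (measurable_heatKernel_sub_real x).aestronglyMeasurable)
    (.of_forall (farPart_bound hs)) (integrable_farPart_bound hs hA) ?_
  · rwa [integral_zero] at h
  · filter_upwards [ae_prod_mem_Ioi] with q hq
    refine (tendsto_heatKernel_cocompact (hs.trans hq)).comp ?_
    exact (Homeomorph.subRight q.2).isClosedEmbedding.tendsto_cocompact

lemma farPart_eq (hs : 0 < s) (x : E3) :
    farPart s A x = (∫⁻ t in Ioi s, heatMass t A x).toReal := by
  unfold farPart heatMass
  rw [integral_eq_lintegral_of_nonneg_ae _ (measurable_heatKernel_sub_real x).aestronglyMeasurable,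
    lintegral_prod _ (measurable_heatKernel_sub_real x).ennreal_ofReal.aemeasurable]
  filter_upwards [ae_prod_mem_Ioi] with q hq
  exact heatKernel_nonneg (hs.trans hq).le _

lemma heatMassInt_ne_top (x : E3) : heatMassInt s A x ≠ ⊤ :=
  ((heatMassInt_le A x).trans_lt ENNReal.ofReal_lt_top).ne

lemma newtonR_eq_add_farPart (hs : 0 < s) (hA : volume A ≠ ⊤) (x : E3) :
    newtonR A x = (heatMassInt s A x).toReal + farPart s A x := by
  have h := newton_ne_top hA x
  rw [newton_eq hs, lintegral_heatKernel_mul_newton hs] at h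
  rw [newtonR_eq_toReal, newton_eq hs, lintegral_heatKernel_mul_newton hs, farPart_eq hs,
    ENNReal.toReal_add (heatMassInt_ne_top x) (ENNReal.add_ne_top.1 h).2]

lemma toReal_heatMassInt_le (hs : 0 < s) (x : E3) : (heatMassInt s A x).toReal ≤ s :=
  (ENNReal.toReal_mono ENNReal.ofReal_ne_top (heatMassInt_le A x)).trans_eq
    (ENNReal.toReal_ofReal hs.le)

end FarPart

variable {A B : Set E3}

lemma continuous_newtonR (hA : volume A ≠ ⊤) : Continuous (newtonR A) := by
  refine continuous_of_uniform_approx_of_continuous fun u hu => ?_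
  obtain ⟨ε, hε, h⟩ := Metric.mem_uniformity_dist.1 hu
  refine ⟨farPart (ε / 2) A, continuous_farPart (half_pos hε) hA, fun y => h ?_⟩
  rw [newtonR_eq_add_farPart (half_pos hε) hA, Real.dist_eq, add_sub_cancel_right,
    abs_of_nonneg ENNReal.toReal_nonneg]
  exact (toReal_heatMassInt_le (half_pos hε) y).trans_lt (half_lt_self hε)

lemma tendsto_newtonR (hA : volume A ≠ ⊤) : Tendsto (newtonR A) (cocompact E3) (𝓝 0) := by
  rw [Metric.tendsto_nhds]
  intro ε hε
  filter_upwards [(Metric.tendsto_nhds.1 (tendsto_farPart (half_pos hε) hA)) (ε / 2) (half_pos hε)]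
    with x hx
  rw [Real.dist_eq, sub_zero, abs_of_nonneg (newtonR_nonneg A x),
    newtonR_eq_add_farPart (half_pos hε) hA]
  rw [Real.dist_eq, sub_zero] at hx
  linarith [toReal_heatMassInt_le (A := A) (half_pos hε) x, le_abs_self (farPart (ε / 2) A x)]

lemma exists_newtonR_le (hA : volume A ≠ ⊤) : ∃ C, 0 ≤ C ∧ ∀ x, newtonR A x ≤ C :=
  ⟨_, add_nonneg zero_le_one (mul_nonneg (farConst_nonneg one_pos) measureReal_nonneg),
    newtonR_le one_pos hA⟩

lemma integrable_mul_newtonR {f : E3 → ℝ} (hf : Integrable f) (hA : volume A ≠ ⊤) :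
    Integrable fun z => f z * newtonR A z := by
  obtain ⟨C, -, hC⟩ := exists_newtonR_le hA
  refine hf.mul_bdd (c := C) (measurable_newtonR A).aestronglyMeasurable (.of_forall fun z => ?_)
  rw [Real.norm_of_nonneg (newtonR_nonneg A z)]
  exact hC z

lemma newtonR_eq {s : ℝ} (hs : 0 < s) (hA : volume A ≠ ⊤) (x : E3) :
    newtonR A x = (heatMassInt s A x).toReal + ∫ z, heatKernel s (x - z) * newtonR A z := by
  rw [newtonR_eq_add_farPart hs hA, farPart_eq hs, ← lintegral_heatKernel_mul_newton hs,
    integral_eq_lintegral_of_nonneg_ae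
      (.of_forall fun z => mul_nonneg (heatKernel_nonneg hs.le _) (newtonR_nonneg A z))
      (integrable_mul_newtonR (integrable_heatKernel_sub hs x) hA).aestronglyMeasurable]
  simp_rw [ENNReal.ofReal_mul (heatKernel_nonneg hs.le _), ofReal_newtonR hA]

lemma potential_eq {P M : Set E3} (hP : MeasurableSet P) (hP' : volume P ≠ ⊤)
    (hM : MeasurableSet M) (hM' : volume M ≠ ⊤) (x : E3) :
    potential P M x = newtonR P x - newtonR M x := by
  have h : ∀ S : Set E3, ∀ y, S.indicator (fun _ => (1 : ℝ)) y * coul x y =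
      S.indicator (coul x) y := fun S y => by
    by_cases hy : y ∈ S <;> simp [hy]
  unfold potential newtonR
  simp_rw [sub_mul, h]
  rw [integral_sub ((integrableOn_coul hP' x).integrable_indicator hP)
    ((integrableOn_coul hM' x).integrable_indicator hM), integral_indicator hP,
    integral_indicator hM]

lemma integrableOn_newtonR (hA : volume A ≠ ⊤) (hB : volume B ≠ ⊤) :
    IntegrableOn (newtonR A) B := by
  obtain ⟨C, -, hC⟩ := exists_newtonR_le hA
  have : IsFiniteMeasure (volume.restrict B) := isFiniteMeasure_restrict.2 hB
  refine Integrable.of_bound (measurable_newtonR A).aestronglyMeasurable C (.of_forall fun z => ?_)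
  rw [Real.norm_of_nonneg (newtonR_nonneg A z)]
  exact hC z

lemma setIntegral_newtonR_comm (hA : volume A ≠ ⊤) (hB : volume B ≠ ⊤) :
    ∫ x in A, newtonR B x = ∫ x in B, newtonR A x := by
  rw [integral_eq_lintegral_of_nonneg_ae (.of_forall (newtonR_nonneg B))
    (measurable_newtonR B).aestronglyMeasurable, integral_eq_lintegral_of_nonneg_ae
    (.of_forall (newtonR_nonneg A)) (measurable_newtonR A).aestronglyMeasurable]
  simp_rw [ofReal_newtonR hA, ofReal_newtonR hB]
  unfold newton
  rw [lintegral_lintegral_swap measurable_coul.ennreal_ofReal.aemeasurable]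
  simp_rw [coul_comm]

lemma newtonR_union (hd : Disjoint A B) (hBm : MeasurableSet B) (hA : volume A ≠ ⊤)
    (hB : volume B ≠ ⊤) (x : E3) : newtonR (A ∪ B) x = newtonR A x + newtonR B x :=
  setIntegral_union hd hBm (integrableOn_coul hA x) (integrableOn_coul hB x)

lemma energy_union {P M B : Set E3} (hP : volume P ≠ ⊤) (hM : volume M ≠ ⊤)
    (hB : volume B ≠ ⊤) (hd : Disjoint M B) (hBm : MeasurableSet B) :
    energy P (M ∪ B) = energy P M - 2 * (∫ x in B, newtonR P x) +
      2 * (∫ x in B, newtonR M x) + ∫ x in B, newtonR B x := by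
  have hU : volume (M ∪ B) ≠ ⊤ := (measure_union_lt_top hM.lt_top hB.lt_top).ne
  have e : ∀ S T : Set E3, ∫ x in S, ∫ y in T, coul x y = ∫ x in S, newtonR T x :=
    fun _ _ => rfl
  unfold energy
  simp_rw [e]
  rw [setIntegral_newtonR_comm hP hU, setIntegral_newtonR_comm hP hM,
    setIntegral_union hd hBm (integrableOn_newtonR hP hM) (integrableOn_newtonR hP hB),
    setIntegral_union hd hBm (integrableOn_newtonR hU hM) (integrableOn_newtonR hU hB)]
  simp_rw [newtonR_union hd hBm hM hB]
  rw [integral_add (integrableOn_newtonR hM hM) (integrableOn_newtonR hB hM),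
    integral_add (integrableOn_newtonR hM hB) (integrableOn_newtonR hB hB),
    setIntegral_newtonR_comm hM hB]
  ring

lemma volume_eq_zero_of_first_variation {ψ : E3 → ℝ} (hψ : Continuous ψ) {D : Set E3}
    (hD : MeasurableSet D) (hpos : ∀ x ∈ D, 0 < ψ x)
    (h : ∀ B ⊆ D, MeasurableSet B → volume B ≠ ⊤ → IntegrableOn ψ B →
      2 * ∫ x in B, ψ x ≤ ∫ x in B, newtonR B x) : volume D = 0 := by
  refine measure_null_of_locally_null D fun x hx => ?_
  set δ := ψ x / 2 with hδ
  have hδ0 : 0 < δ := half_pos (hpos x hx)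
  have h1 : ∀ᶠ r : ℝ in 𝓝[>] 0, farConst δ * volume.real (Metric.ball x r) < δ := by
    have h2 : Tendsto (fun r : ℝ => farConst δ * (r ^ 3 * volume.real (Metric.ball (0 : E3) 1)))
        (𝓝[>] 0) (𝓝 0) := by
      refine tendsto_nhdsWithin_of_tendsto_nhds ?_
      exact Continuous.tendsto' (by fun_prop) _ _ (by simp)
    filter_upwards [h2.eventually_lt_const hδ0, self_mem_nhdsWithin] with r hr hr0
    rw [← Measure.addHaar_real_closedBall_eq_addHaar_real_ball,
      Measure.addHaar_real_closedBall _ _ (le_of_lt hr0)]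
    simpa using hr
  have h2 : ∀ᶠ r : ℝ in 𝓝[>] 0, Metric.ball x r ⊆ {y | ψ y ∈ Icc δ (ψ x + 1)} := by
    have h3 : {y | ψ y ∈ Icc δ (ψ x + 1)} ∈ 𝓝 x :=
      hψ.continuousAt (Icc_mem_nhds (half_lt_self (hpos x hx)) (lt_add_one _))
    obtain ⟨ε, hε, hb⟩ := Metric.mem_nhds_iff.1 h3
    filter_upwards [Ioo_mem_nhdsGT hε] with r hr
    exact (Metric.ball_subset_ball hr.2.le).trans hb
  obtain ⟨r, hr1, hr2, hr0⟩ := (h1.and (h2.and self_mem_nhdsWithin)).exists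
  refine ⟨D ∩ Metric.ball x r, inter_mem self_mem_nhdsWithin
    (mem_nhdsWithin_of_mem_nhds (Metric.ball_mem_nhds x hr0)), ?_⟩
  set B := D ∩ Metric.ball x r with hBdef
  have hBm : MeasurableSet B := hD.inter Metric.isOpen_ball.measurableSet
  have hBle : volume B ≤ volume (Metric.ball x r) := measure_mono inter_subset_right
  have hB : volume B ≠ ⊤ := (hBle.trans_lt measure_ball_lt_top).ne
  have : IsFiniteMeasure (volume.restrict B) := isFiniteMeasure_restrict.2 hB
  have hint : IntegrableOn ψ B := by
    refine Integrable.of_bound hψ.aestronglyMeasurable (ψ x + 1) ?_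
    filter_upwards [ae_restrict_mem hBm] with y hy
    have := hr2 hy.2
    rw [Real.norm_of_nonneg (hδ0.le.trans this.1)]
    exact this.2
  have hv := h B inter_subset_left hBm hB hint
  have e1 : δ * volume.real B ≤ ∫ x in B, ψ x := by
    have := setIntegral_mono_on (f := fun _ => δ) (integrable_const δ) hint hBm
      fun y hy => (hr2 hy.2).1
    simpa [mul_comm] using this
  have e2 : ∫ x in B, newtonR B x ≤ (δ + farConst δ * volume.real B) * volume.real B := by
    have := setIntegral_mono_on (g := fun _ => δ + farConst δ * volume.real B)
      (integrableOn_newtonR hB hB) (integrable_const _) hBm fun y hy => newtonR_le hδ0 hB y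
    simpa [mul_comm] using this
  have e3 : farConst δ * volume.real B < δ :=
    (mul_le_mul_of_nonneg_left (measureReal_mono inter_subset_right measure_ball_lt_top.ne)
      (farConst_nonneg hδ0)).trans_lt hr1
  have e4 : volume.real B = 0 := by
    by_contra hne
    have : 0 < volume.real B := lt_of_le_of_ne measureReal_nonneg (Ne.symm hne)
    nlinarith
  exact (measureReal_eq_zero_iff hB).1 e4

lemma toReal_heatMassInt_le_of_inter_ball {s r : ℝ} (hs : 0 < s) (hr : 0 < r) {x : E3}
    (h : volume (A ∩ Metric.ball x r) = 0) : (heatMassInt s A x).toReal ≤ 24 * s / r ^ 2 * s :=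
  ENNReal.toReal_le_of_le_ofReal (by positivity) (heatMassInt_le_of_inter_ball hs hr h)

lemma toReal_heatMassInt_add_compl {s : ℝ} (hs : 0 < s) (hA : MeasurableSet A) (x : E3) :
    (heatMassInt s A x).toReal + (heatMassInt s Aᶜ x).toReal = s := by
  rw [← ENNReal.toReal_add (heatMassInt_ne_top x) (heatMassInt_ne_top x),
    heatMassInt_add_compl hA, ENNReal.toReal_ofReal hs.le]

lemma le_toReal_heatMassInt_of_ball_subset {s r : ℝ} (hs : 0 < s) (hr : 0 < r)
    (hA : MeasurableSet A) {x : E3} (h : Metric.ball x r ⊆ A) :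
    s - 24 * s / r ^ 2 * s ≤ (heatMassInt s A x).toReal := by
  have h1 : Aᶜ ∩ Metric.ball x r = ∅ :=
    (disjoint_compl_left_iff_subset.2 h).inter_eq
  have h2 := toReal_heatMassInt_le_of_inter_ball (A := Aᶜ) hs hr (by rw [h1, measure_empty])
  linarith [toReal_heatMassInt_add_compl hs hA x]

lemma toReal_heatMassInt_mono {s : ℝ} (h : A ≤ᵐ[volume] B) (x : E3) :
    (heatMassInt s A x).toReal ≤ (heatMassInt s B x).toReal :=
  ENNReal.toReal_mono (heatMassInt_ne_top x) (heatMassInt_mono h s x)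

lemma le_integral_heatKernel_mul {s a : ℝ} (hs : 0 < s) {x : E3} {f : E3 → ℝ}
    (hf : Integrable fun z => heatKernel s (x - z) * f z) (ha : ∀ z, a ≤ f z) :
    a ≤ ∫ z, heatKernel s (x - z) * f z := by
  have h := integral_mono ((integrable_heatKernel_sub hs x).mul_const a) hf fun z =>
    mul_le_mul_of_nonneg_left (ha z) (heatKernel_nonneg hs.le (x - z))
  rwa [integral_mul_const, integral_heatKernel_sub hs, one_mul] at h

section SecondMoment

variable {s : ℝ}

lemma integrable_heatKernel_mul_sq (hs : 0 < s) :
    Integrable fun w : E3 => heatKernel s w * ‖w‖ ^ 2 := by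
  refine ((integrable_heatKernel (t := 2 * s) (by positivity)).const_mul (24 * s)).mono'
    ((continuous_heatKernel s).mul (by fun_prop)).aestronglyMeasurable (.of_forall fun w => ?_)
  rw [Real.norm_of_nonneg (mul_nonneg (heatKernel_nonneg hs.le w) (by positivity))]
  exact heatKernel_mul_sq_le hs w

lemma integral_heatKernel_mul_sq_le (hs : 0 < s) :
    ∫ w : E3, heatKernel s w * ‖w‖ ^ 2 ≤ 24 * s := by
  have h := integral_mono (integrable_heatKernel_mul_sq hs)
    ((integrable_heatKernel (t := 2 * s) (by positivity)).const_mul (24 * s))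
    fun w => heatKernel_mul_sq_le hs w
  rwa [integral_const_mul, integral_heatKernel (by positivity), mul_one] at h

lemma integrable_heatKernel_mul_norm_add_sq (hs : 0 < s) (v : E3) :
    Integrable fun w : E3 => heatKernel s w * ‖w + v‖ ^ 2 := by
  refine (((integrable_heatKernel_mul_sq hs).const_mul 2).add
    ((integrable_heatKernel hs).mul_const (2 * ‖v‖ ^ 2))).mono'
    ((continuous_heatKernel s).mul (by fun_prop)).aestronglyMeasurable (.of_forall fun w => ?_)
  have h0 := heatKernel_nonneg hs.le w
  rw [Real.norm_of_nonneg (mul_nonneg h0 (by positivity))]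
  have h1 := parallelogram_law_with_norm ℝ w v
  simp only [Pi.add_apply]
  nlinarith [mul_nonneg h0 (mul_self_nonneg ‖w - v‖)]

lemma integral_heatKernel_mul_norm_add_sq_le (hs : 0 < s) (v : E3) :
    ∫ w : E3, heatKernel s w * ‖w + v‖ ^ 2 ≤ ‖v‖ ^ 2 + 24 * s := by
  have h1 : ∫ w : E3, heatKernel s w * ‖w - v‖ ^ 2 = ∫ w : E3, heatKernel s w * ‖w + v‖ ^ 2 := by
    rw [← integral_neg_eq_self]
    refine integral_congr_ae (.of_forall fun w => ?_)
    simp only [heatKernel_neg]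
    rw [← norm_neg (-w - v)]
    congr 3
    abel
  have h2 := integral_add (integrable_heatKernel_mul_norm_add_sq hs v)
    (by simpa [sub_eq_add_neg] using integrable_heatKernel_mul_norm_add_sq hs (-v) :
      Integrable fun w : E3 => heatKernel s w * ‖w - v‖ ^ 2)
  have h3 : ∀ w : E3, heatKernel s w * ‖w + v‖ ^ 2 + heatKernel s w * ‖w - v‖ ^ 2 =
      2 * (heatKernel s w * ‖w‖ ^ 2) + heatKernel s w * (2 * ‖v‖ ^ 2) := fun w => by
    have := parallelogram_law_with_norm ℝ w v
    linear_combination heatKernel s w * this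
  simp_rw [h3] at h2
  rw [integral_add ((integrable_heatKernel_mul_sq hs).const_mul 2)
    ((integrable_heatKernel hs).mul_const _), integral_const_mul, integral_mul_const,
    integral_heatKernel hs, h1] at h2
  linarith [integral_heatKernel_mul_sq_le hs]

lemma integrable_heatKernel_sub_mul_norm_sub_sq (hs : 0 < s) (y c : E3) :
    Integrable fun z : E3 => heatKernel s (y - z) * ‖z - c‖ ^ 2 := by
  have h := (integrable_heatKernel_mul_norm_add_sq hs (c - y)).comp_sub_left y
  refine h.congr (.of_forall fun z => ?_)
  simp only
  rw [norm_sub_rev z c]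
  congr 3
  abel

lemma integral_heatKernel_sub_mul_norm_sub_sq_le (hs : 0 < s) (y c : E3) :
    ∫ z : E3, heatKernel s (y - z) * ‖z - c‖ ^ 2 ≤ ‖y - c‖ ^ 2 + 24 * s := by
  rw [← norm_sub_rev c y]
  refine le_of_eq_of_le ?_ (integral_heatKernel_mul_norm_add_sq_le hs (c - y))
  rw [← integral_sub_left_eq_self _ volume y]
  refine integral_congr_ae (.of_forall fun z => ?_)
  simp only
  rw [sub_sub_cancel, ← norm_neg (y - z - c)]
  congr 3
  abel

end SecondMoment

/-- The potential of two charged sets, as a difference of Newton potentials. -/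
def newtonDiff (P M : Set E3) (x : E3) : ℝ := newtonR P x - newtonR M x

section NewtonDiff

variable {P M : Set E3}

lemma continuous_newtonDiff (hP : volume P ≠ ⊤) (hM : volume M ≠ ⊤) :
    Continuous (newtonDiff P M) :=
  (continuous_newtonR hP).sub (continuous_newtonR hM)

lemma tendsto_newtonDiff (hP : volume P ≠ ⊤) (hM : volume M ≠ ⊤) :
    Tendsto (newtonDiff P M) (cocompact E3) (𝓝 0) := by
  have h := (tendsto_newtonR hP).sub (tendsto_newtonR hM)
  rwa [sub_zero] at h

lemma integrable_mul_newtonDiff {f : E3 → ℝ} (hf : Integrable f) (hP : volume P ≠ ⊤)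
    (hM : volume M ≠ ⊤) : Integrable fun z => f z * newtonDiff P M z := by
  simp_rw [newtonDiff, mul_sub]
  exact (integrable_mul_newtonR hf hP).sub (integrable_mul_newtonR hf hM)

lemma integral_heatKernel_mul_newtonDiff {s : ℝ} (hs : 0 < s) (hP : volume P ≠ ⊤)
    (hM : volume M ≠ ⊤) (x : E3) :
    ∫ z, heatKernel s (x - z) * newtonDiff P M z =
      newtonDiff P M x - (heatMassInt s P x).toReal + (heatMassInt s M x).toReal := by
  simp_rw [newtonDiff, mul_sub]
  rw [integral_sub (integrable_mul_newtonR (integrable_heatKernel_sub hs x) hP)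
    (integrable_mul_newtonR (integrable_heatKernel_sub hs x) hM), newtonR_eq hs hP x,
    newtonR_eq hs hM x]
  ring

/-- A potential which is nonnegative almost everywhere on the negative charges is nonnegative. -/
lemma newtonDiff_nonneg (hP : volume P ≠ ⊤) (hM : volume M ≠ ⊤)
    (hneg : volume (M ∩ {x | newtonDiff P M x < 0}) = 0) (x : E3) : 0 ≤ newtonDiff P M x := by
  by_contra! hx
  set m := newtonDiff P M x / 2 with hm
  have hm0 : m < 0 := by linarith
  obtain ⟨K, hK, hKm⟩ := mem_cocompact.1 ((tendsto_newtonDiff hP hM).eventually_const_lt hm0)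
  obtain ⟨R, hR⟩ := hK.isBounded.subset_ball (0 : E3)
  set B := Metric.ball (0 : E3) R
  have hB : volume B ≠ ⊤ := measure_ball_lt_top.ne
  obtain ⟨C, hC0, hC⟩ := exists_newtonR_le hB
  set ε := -m / (C + 1) with hε
  have hε0 : 0 < ε := div_pos (by linarith) (by linarith)
  have hεC : ε * C < -m := by
    rw [hε, div_mul_eq_mul_div, div_lt_iff₀ (by linarith)]
    nlinarith
  set f := fun z => newtonDiff P M z + ε * newtonR B z with hf
  have hfx : f x < m := by
    have := mul_le_mul_of_nonneg_left (hC x) hε0.le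
    simp only [hf]
    linarith
  have hfc : Continuous f :=
    (continuous_newtonDiff hP hM).add (continuous_const.mul (continuous_newtonR hB))
  have hft : Tendsto f (cocompact E3) (𝓝 0) := by
    simpa using (tendsto_newtonDiff hP hM).add ((tendsto_newtonR hB).const_mul ε)
  obtain ⟨y, hy⟩ := hfc.exists_forall_le' x
    ((hft.eventually_const_lt (hfx.trans hm0)).mono fun z hz => hz.le)
  have hym : newtonDiff P M y < m :=
    (le_add_of_nonneg_right (mul_nonneg hε0.le (newtonR_nonneg B y))).trans_lt
      ((hy x).trans_lt hfx)
  have hyB : y ∈ B := hR (by_contra fun h => (hKm h).not_gt hym)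
  have hnhds : B ∩ {z | newtonDiff P M z < 0} ∈ 𝓝 y :=
    inter_mem (Metric.isOpen_ball.mem_nhds hyB)
      ((continuous_newtonDiff hP hM).continuousAt.eventually_lt_const (hym.trans hm0))
  obtain ⟨r, hr, hrB⟩ := Metric.mem_nhds_iff.1 hnhds
  set q := ε / (2 * (1 + ε)) with hq
  have hq0 : 0 < q := by positivity
  set s := q * r ^ 2 / 24 with hs
  have hs0 : 0 < s := by positivity
  have hsq : 24 * s / r ^ 2 = q := by rw [hs]; field_simp
  have hkM : (heatMassInt s M y).toReal ≤ q * s := by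
    rw [← hsq]
    exact toReal_heatMassInt_le_of_inter_ball hs0 hr
      (measure_mono_null (inter_subset_inter_right _ (hrB.trans inter_subset_right)) hneg)
  have hkB : s - q * s ≤ (heatMassInt s B y).toReal := by
    rw [← hsq]
    exact le_toReal_heatMassInt_of_ball_subset hs0 hr Metric.isOpen_ball.measurableSet
      (hrB.trans inter_subset_left)
  have hi1 := integrable_mul_newtonDiff (integrable_heatKernel_sub hs0 y) hP hM
  have hi2 := (integrable_mul_newtonR (integrable_heatKernel_sub hs0 y) hB).const_mul ε
  have hfe : (fun z => heatKernel s (y - z) * f z) = fun z =>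
      heatKernel s (y - z) * newtonDiff P M z + ε * (heatKernel s (y - z) * newtonR B z) := by
    funext z; simp only [hf]; ring
  have htest := le_integral_heatKernel_mul (x := y) hs0 (by rw [hfe]; exact hi1.add hi2) hy
  rw [hfe, integral_add hi1 hi2, integral_const_mul, integral_heatKernel_mul_newtonDiff hs0 hP hM]
    at htest
  have hBy := newtonR_eq hs0 hB y
  simp only [hf] at htest
  rw [hBy] at htest
  have hkP : 0 ≤ (heatMassInt s P y).toReal := ENNReal.toReal_nonneg
  have hkey : ε * (s - q * s) ≤ q * s := by
    have := mul_le_mul_of_nonneg_left hkB hε0.le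
    linarith
  have hq2 : q * (1 + ε) = ε / 2 := by rw [hq]; field_simp
  nlinarith [mul_pos hε0 hs0]

/-- Lower barrier for a nonnegative potential in a ball of positive charges. -/
lemma le_newtonDiff_of_ball_subset (hP : volume P ≠ ⊤) (hM : volume M ≠ ⊤)
    (hnn : ∀ x, 0 ≤ newtonDiff P M x) (hPm : MeasurableSet P) (hPM : volume (P ∩ M) = 0)
    {c : E3} {ρ : ℝ} (hρ : 0 < ρ) (hball : Metric.ball c ρ ⊆ P) (z : E3) :
    (ρ ^ 2 - ‖z - c‖ ^ 2) / 48 ≤ newtonDiff P M z := by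
  set f := fun z => newtonDiff P M z + ‖z - c‖ ^ 2 * (1 / 48) with hf
  suffices h : ∀ z, ρ ^ 2 / 48 ≤ f z by
    have := h z
    simp only [hf] at this
    linarith
  by_contra! ⟨x, hx⟩
  have hfc : Continuous f := (continuous_newtonDiff hP hM).add (by fun_prop)
  have hlarge : ∀ z, ρ ≤ ‖z - c‖ → f x ≤ f z := fun z hz => by
    have : ρ ^ 2 ≤ ‖z - c‖ ^ 2 := by gcongr
    have := hnn z
    simp only [hf] at hx ⊢
    linarith
  obtain ⟨y, hy⟩ := hfc.exists_forall_le' x <| mem_cocompact.2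
    ⟨Metric.closedBall c ρ, isCompact_closedBall c ρ, fun z hz => hlarge z <| by
      rw [mem_compl_iff, Metric.mem_closedBall, not_le, dist_eq_norm] at hz
      exact hz.le⟩
  have hyc : ‖y - c‖ < ρ := by
    have h1 := (hy x).trans_lt hx
    have h2 := hnn y
    simp only [hf] at h1
    exact lt_of_pow_lt_pow_left₀ 2 hρ.le (by linarith)
  obtain ⟨r, hr, hrB⟩ := Metric.isOpen_iff.1 Metric.isOpen_ball y
    (show y ∈ Metric.ball c ρ by rwa [Metric.mem_ball, dist_eq_norm])
  set s := 1 / 8 * r ^ 2 / 24 with hs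
  have hs0 : 0 < s := by positivity
  have hsq : 24 * s / r ^ 2 = 1 / 8 := by rw [hs]; field_simp
  have hkP := le_toReal_heatMassInt_of_ball_subset hs0 hr hPm (hrB.trans hball)
  have hkM := toReal_heatMassInt_le_of_inter_ball (A := M) (x := y) hs0 hr
    (measure_mono_null (by rw [inter_comm]; exact inter_subset_inter_left _ (hrB.trans hball)) hPM)
  rw [hsq] at hkP hkM
  have hi1 := integrable_mul_newtonDiff (integrable_heatKernel_sub hs0 y) hP hM
  have hi2 := (integrable_heatKernel_sub_mul_norm_sub_sq hs0 y c).mul_const (1 / 48)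
  have hfe : (fun z => heatKernel s (y - z) * f z) = fun z =>
      heatKernel s (y - z) * newtonDiff P M z + heatKernel s (y - z) * ‖z - c‖ ^ 2 * (1 / 48) := by
    funext z; simp only [hf]; ring
  have htest := le_integral_heatKernel_mul (x := y) hs0 (by rw [hfe]; exact hi1.add hi2) hy
  rw [hfe, integral_add hi1 hi2, integral_mul_const, integral_heatKernel_mul_newtonDiff hs0 hP hM]
    at htest
  simp only [hf] at htest
  linarith [integral_heatKernel_sub_mul_norm_sub_sq_le hs0 y c]

/-- Quadratic growth of a nonnegative potential away from its zeros. -/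
lemma newtonDiff_le_of_eq_zero (hP : volume P ≠ ⊤) (hM : volume M ≠ ⊤)
    (hnn : ∀ x, 0 ≤ newtonDiff P M x) {x : E3} (hx : newtonDiff P M x = 0) {s : ℝ} (hs : 0 < s)
    (z : E3) : newtonDiff P M z ≤ s * (1 + 32 * Real.exp (‖z - x‖ ^ 2 / (8 * s))) := by
  have h4s : 0 < 4 * s := by positivity
  set E := Real.exp (‖z - x‖ ^ 2 / (8 * s))
  have hker : ∀ y, heatKernel s (z - y) ≤ 8 * E * heatKernel (4 * s) (x - y) := fun y => by
    have h8 : (4 * π * s) ^ (-(3 / 2) : ℝ) = 8 * (4 * π * (4 * s)) ^ (-(3 / 2) : ℝ) := by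
      have h8' : (4 : ℝ) ^ (-(3 / 2) : ℝ) = 1 / 8 := by
        rw [show (4 : ℝ) = 2 ^ (2 : ℝ) by norm_num, ← Real.rpow_mul (by norm_num)]
        norm_num
      rw [show 4 * π * (4 * s) = 4 * (4 * π * s) by ring,
        Real.mul_rpow (x := 4) (by norm_num) (by positivity), h8']
      ring
    have hexp : Real.exp (-‖z - y‖ ^ 2 / (4 * s)) ≤
        E * Real.exp (-‖x - y‖ ^ 2 / (4 * (4 * s))) := by
      rw [← Real.exp_add, Real.exp_le_exp]
      have h1 : ‖x - y‖ ^ 2 ≤ 2 * ‖z - x‖ ^ 2 + 2 * ‖z - y‖ ^ 2 := by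
        have h2 := norm_sub_le (z - y) (z - x)
        rw [sub_sub_sub_cancel_left] at h2
        nlinarith [norm_nonneg (x - y), sq_nonneg (‖z - y‖ - ‖z - x‖)]
      have h3 : 0 ≤ ‖z - y‖ ^ 2 := by positivity
      rw [div_add_div _ _ (by positivity) (by positivity), div_le_div_iff₀ (by positivity)
        (by positivity)]
      have h5 : 0 ≤ 2 * ‖z - x‖ ^ 2 + 4 * ‖z - y‖ ^ 2 - ‖x - y‖ ^ 2 := by linarith
      have h6 : 0 < s ^ 2 := by positivity
      nlinarith [mul_nonneg h6.le h5]
    unfold heatKernel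
    rw [h8]
    have := mul_le_mul_of_nonneg_left hexp
      (show 0 ≤ 8 * (4 * π * (4 * s)) ^ (-(3 / 2) : ℝ) by positivity)
    linarith
  have h1 := integral_heatKernel_mul_newtonDiff hs hP hM z
  have h2 := integral_heatKernel_mul_newtonDiff h4s hP hM x
  have h3 := integral_mono (integrable_mul_newtonDiff (integrable_heatKernel_sub hs z) hP hM)
    ((integrable_mul_newtonDiff (integrable_heatKernel_sub h4s x) hP hM).const_mul (8 * E))
    fun y => by
      have := mul_le_mul_of_nonneg_right (hker y) (hnn y)
      simp only
      linarith
  rw [integral_const_mul, h1, h2, hx] at h3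
  have hE : 0 < E := Real.exp_pos _
  have k1 := toReal_heatMassInt_le (A := P) hs z
  have k2 := toReal_heatMassInt_le (A := M) h4s x
  have k3 : 0 ≤ (heatMassInt s M z).toReal := ENNReal.toReal_nonneg
  have k4 : 0 ≤ (heatMassInt (4 * s) P x).toReal := ENNReal.toReal_nonneg
  nlinarith [mul_le_mul_of_nonneg_left k2 hE.le, mul_nonneg hE.le k4]

lemma newtonDiff_pos_of_mem_sphere (hP : volume P ≠ ⊤) (hM : volume M ≠ ⊤)
    (hnn : ∀ x, 0 ≤ newtonDiff P M x) (hPm : MeasurableSet P) (hPM : volume (P ∩ M) = 0)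
    {c : E3} {ρ : ℝ} (hρ : 0 < ρ) (hball : Metric.ball c ρ ⊆ P) {x : E3} (hx : dist x c = ρ) :
    0 < newtonDiff P M x := by
  refine lt_of_le_of_ne (hnn x) fun h0 => ?_
  set τ : ℝ := 1 / 10000 with hτ
  set z := x + τ • (c - x)
  have hcx : ‖c - x‖ = ρ := by rw [← dist_eq_norm, dist_comm, hx]
  have hzc : ‖z - c‖ = (1 - τ) * ρ := by
    rw [show z - c = (1 - τ) • (x - c) by module, norm_smul, norm_sub_rev x c, hcx,
      Real.norm_of_nonneg (by norm_num [hτ])]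
  have hzx : ‖z - x‖ = τ * ρ := by
    rw [add_sub_cancel_left, norm_smul, hcx, Real.norm_of_nonneg (by norm_num [hτ])]
  have h1 := le_newtonDiff_of_ball_subset hP hM hnn hPm hPM hρ hball z
  have hs : 0 < (τ * ρ) ^ 2 := by positivity
  have h2 := newtonDiff_le_of_eq_zero hP hM hnn h0.symm hs z
  rw [hzc] at h1
  have h3 : Real.exp (‖z - x‖ ^ 2 / (8 * (τ * ρ) ^ 2)) ≤ 3 := by
    rw [hzx, mul_comm (8 : ℝ), div_mul_eq_div_div, div_self hs.ne']
    refine (Real.exp_le_exp.2 (by norm_num)).trans (Real.exp_one_lt_d9.le.trans (by norm_num))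
  have h4 := mul_le_mul_of_nonneg_left h3 hs.le
  have h5 : 0 < ρ ^ 2 := by positivity
  rw [hτ] at h1 h2 h4
  nlinarith

end NewtonDiff

/-- At almost every point outside `D` the heat flow of the indicator of `D` is small for small
times. -/
lemma ae_eventually_heatMass_le {D : Set E3} (hD : MeasurableSet D) :
    ∀ᵐ x ∂(volume : Measure E3), x ∉ D → ∀ η : ℝ, 0 < η →
      ∀ᶠ t in 𝓝[>] (0 : ℝ), heatMass t D x ≤ ENNReal.ofReal η := by
  filter_upwards [Besicovitch.ae_tendsto_measure_inter_div_of_measurableSet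
    (volume : Measure E3) hD] with x hx hxD η hη
  rw [indicator_of_notMem hxD] at hx
  set V := volume.real (Metric.ball (0 : E3) 1) with hV
  have hV0 : 0 < V := ENNReal.toReal_pos (Metric.measure_ball_pos _ _ one_pos).ne'
    measure_ball_lt_top.ne
  set L := √(48 / η) with hL
  have hL0 : 0 < L := Real.sqrt_pos.2 (by positivity)
  have hL2 : L ^ 2 = 48 / η := Real.sq_sqrt (by positivity)
  set κ := η / (2 * (L ^ 3 * V)) with hκ
  have hκ0 : 0 < κ := by positivity
  have hr : Tendsto (fun t : ℝ => L * √t) (𝓝[>] 0) (𝓝[>] 0) := by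
    refine tendsto_nhdsWithin_iff.2 ⟨tendsto_nhdsWithin_of_tendsto_nhds
      (Continuous.tendsto' (by fun_prop) _ _ (by simp)), ?_⟩
    filter_upwards [self_mem_nhdsWithin] with t ht
    exact mul_pos hL0 (Real.sqrt_pos.2 ht)
  filter_upwards [(hx.comp hr).eventually_le_const (ENNReal.ofReal_pos.2 hκ0),
    self_mem_nhdsWithin] with t ht ht0
  have ht0 : 0 < t := ht0
  set r := L * √t with hrdef
  have hr0 : 0 < r := mul_pos hL0 (Real.sqrt_pos.2 ht0)
  have hr2 : r ^ 2 = L ^ 2 * t := by rw [hrdef, mul_pow, Real.sq_sqrt ht0.le]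
  set Q := Metric.closedBall x r
  have hQ : MeasurableSet Q := Metric.isClosed_closedBall.measurableSet
  have hQ0 : 0 < volume Q := Metric.measure_closedBall_pos _ _ hr0
  have hQtop : volume Q ≠ ⊤ := measure_closedBall_lt_top.ne
  have hvQ : volume.real Q = r ^ 3 * V := by
    simpa using Measure.addHaar_real_closedBall (volume : Measure E3) x hr0.le
  have hDQ : volume (D ∩ Q) ≤ ENNReal.ofReal (κ * (r ^ 3 * V)) := by
    have := (ENNReal.div_le_iff hQ0.ne' hQtop).1 ht
    rwa [← ofReal_measureReal hQtop, hvQ, ← ENNReal.ofReal_mul hκ0.le] at this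
  have hpow : (4 * π * t) ^ (-(3 / 2) : ℝ) * r ^ 3 ≤ L ^ 3 := by
    have h1 : (4 * π * t) ^ (-(3 / 2) : ℝ) ≤ t ^ (-(3 / 2) : ℝ) :=
      Real.rpow_le_rpow_of_nonpos ht0 (by nlinarith [Real.pi_gt_three]) (by norm_num)
    have h2 : t ^ (-(3 / 2) : ℝ) * √t ^ 3 = 1 := by
      rw [Real.sqrt_eq_rpow, ← Real.rpow_natCast, ← Real.rpow_mul ht0.le, ← Real.rpow_add ht0]
      norm_num
    calc (4 * π * t) ^ (-(3 / 2) : ℝ) * r ^ 3 ≤ t ^ (-(3 / 2) : ℝ) * r ^ 3 := by gcongr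
      _ = L ^ 3 * (t ^ (-(3 / 2) : ℝ) * √t ^ 3) := by rw [hrdef]; ring
      _ = L ^ 3 := by rw [h2, mul_one]
  have hnear : heatMass t (D ∩ Q) x ≤ ENNReal.ofReal (η / 2) := by
    refine (lintegral_mono fun y => ENNReal.ofReal_le_ofReal (heatKernel_le ht0 (x - y))).trans ?_
    rw [setLIntegral_const]
    refine (mul_le_mul_right hDQ _).trans ?_
    rw [← ENNReal.ofReal_mul (by positivity)]
    refine ENNReal.ofReal_le_ofReal ?_
    calc (4 * π * t) ^ (-(3 / 2) : ℝ) * (κ * (r ^ 3 * V))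
        = κ * V * ((4 * π * t) ^ (-(3 / 2) : ℝ) * r ^ 3) := by ring
      _ ≤ κ * V * L ^ 3 := by gcongr
      _ = η / 2 := by rw [hκ]; field_simp
  have hfar : heatMass t (D \ Q) x ≤ ENNReal.ofReal (η / 2) := by
    have hempty : D \ Q ∩ Metric.ball x r = ∅ := by
      ext y
      simp only [mem_inter_iff, Set.mem_sdiff, mem_empty_iff_false, iff_false]
      exact fun h => h.1.2 (Metric.ball_subset_closedBall h.2)
    refine (heatMass_le_of_inter_ball ht0 hr0 (by rw [hempty, measure_empty])).trans_eq ?_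
    congr 1
    rw [hr2, hL2]
    field_simp
    norm_num
  calc heatMass t D x = heatMass t (D ∩ Q) x + heatMass t (D \ Q) x :=
        (lintegral_inter_add_sdiff _ D hQ).symm
    _ ≤ ENNReal.ofReal (η / 2) + ENNReal.ofReal (η / 2) := add_le_add hnear hfar
    _ = ENNReal.ofReal η := by
        rw [← ENNReal.ofReal_add (by positivity) (by positivity), add_halves]

/-- A nonnegative potential vanishes almost nowhere on the negative charges. -/
lemma volume_inter_newtonDiff_eq_zero {P M : Set E3} (hP : volume P ≠ ⊤) (hM : volume M ≠ ⊤)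
    (hnn : ∀ x, 0 ≤ newtonDiff P M x) (hMm : MeasurableSet M) (hPM : volume (P ∩ M) = 0) :
    volume (M ∩ {x | newtonDiff P M x = 0}) = 0 := by
  set N := M ∩ {x | newtonDiff P M x = 0} with hN
  have hNm : MeasurableSet N :=
    hMm.inter (isClosed_eq (continuous_newtonDiff hP hM) continuous_const).measurableSet
  refine measure_mono_null ?_ (ae_iff.1 (ae_eventually_heatMass_le hNm.compl))
  intro x hxN hx
  have hx0 : newtonDiff P M x = 0 := hxN.2
  obtain ⟨t₀, ht₀, hsmall⟩ := (mem_nhdsGT_iff_exists_Ioo_subset (a := (0 : ℝ))).1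
    (hx (not_not_intro hxN) (1 / 200) (by norm_num))
  have ht₀ : 0 < t₀ := ht₀
  set s := t₀ / 4 with hs
  have hs0 : 0 < s := by positivity
  have hk : (heatMassInt s Nᶜ x).toReal ≤ 1 / 200 * s := by
    refine ENNReal.toReal_le_of_le_ofReal (by positivity) ?_
    rw [ENNReal.ofReal_mul (by norm_num)]
    exact heatMassInt_le_mul fun t ht => hsmall ⟨ht.1, by linarith [ht.2]⟩
  have h2s : (heatMass (2 * s) Nᶜ x).toReal ≤ 1 / 200 :=
    ENNReal.toReal_le_of_le_ofReal (by norm_num) (hsmall ⟨by positivity, by linarith⟩)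
  have hPN : P ≤ᵐ[volume] (Nᶜ : Set E3) := by
    filter_upwards [measure_eq_zero_iff_ae_notMem.1 hPM] with y hy hyP hyN
    exact hy ⟨hyP, hyN.1⟩
  have hkP : (heatMassInt s P x).toReal ≤ (heatMassInt s Nᶜ x).toReal :=
    toReal_heatMassInt_mono hPN x
  have hkM := toReal_heatMassInt_mono (s := s) (LE.le.eventuallyLE inter_subset_left :
    N ≤ᵐ[volume] M) x
  have hkN := toReal_heatMassInt_add_compl hs0 hNm x
  have hmean := integral_heatKernel_mul_newtonDiff hs0 hP hM x
  have hzero : ∀ z ∉ Nᶜ, heatKernel s (x - z) * newtonDiff P M z = 0 := fun z hz => by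
    rw [(not_not.1 hz : z ∈ N).2, mul_zero]
  rw [← setIntegral_eq_integral_of_forall_compl_eq_zero hzero] at hmean
  have hle : ∀ z, heatKernel s (x - z) * newtonDiff P M z ≤
      99 * s * heatKernel (2 * s) (x - z) := fun z => by
    have h0 := heatKernel_nonneg hs0.le (x - z)
    have h1 := newtonDiff_le_of_eq_zero hP hM hnn hx0 hs0 z
    have h2 := heatKernel_mul_exp_le hs0 (x - z)
    rw [norm_sub_rev x z] at h2
    have h3 : 1 ≤ Real.exp (‖z - x‖ ^ 2 / (8 * s)) := Real.one_le_exp (by positivity)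
    set E := Real.exp (‖z - x‖ ^ 2 / (8 * s))
    calc heatKernel s (x - z) * newtonDiff P M z ≤ heatKernel s (x - z) * (s * (33 * E)) := by
          gcongr
          refine h1.trans ?_
          gcongr
          linarith
      _ = 33 * s * (heatKernel s (x - z) * E) := by ring
      _ ≤ 33 * s * (3 * heatKernel (2 * s) (x - z)) := by gcongr
      _ = _ := by ring
  have hup := setIntegral_mono (s := Nᶜ)
    (integrable_mul_newtonDiff (integrable_heatKernel_sub hs0 x) hP hM).integrableOn
    ((integrable_heatKernel_sub (t := 2 * s) (by positivity) x).const_mul (99 * s)).integrableOn hle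
  have hheat : ∫ z in Nᶜ, heatKernel (2 * s) (x - z) = (heatMass (2 * s) Nᶜ x).toReal :=
    integral_eq_lintegral_of_nonneg_ae (.of_forall fun z => heatKernel_nonneg (by positivity) _)
      (integrable_heatKernel_sub (by positivity) x).aestronglyMeasurable.restrict
  rw [integral_const_mul, hheat, hmean, hx0] at hup
  have h99 := mul_le_mul_of_nonneg_left h2s (show 0 ≤ 99 * s by positivity)
  linarith

lemma volume_graph_eq_zero {ν x : E3} (hν : ‖ν‖ = 1) {ψ : E3 → ℝ} (hψ : Continuous ψ) :
    volume {y : E3 | ψ (y - x - ⟪y - x, ν⟫ • ν) = ⟪y - x, ν⟫} = 0 := by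
  have hνν : ⟪ν, ν⟫ = 1 := by rw [real_inner_self_eq_norm_sq, hν, one_pow]
  refine Measure.addHaar_eq_zero_of_disjoint_translates volume
    (fun n : ℕ => (1 / ((n : ℝ) + 1)) • ν) ?_ ?_ ?_
  · refine (Metric.isBounded_closedBall (x := (0 : E3)) (r := 1)).subset ?_
    rintro _ ⟨n, rfl⟩
    rw [mem_closedBall_zero_iff, norm_smul, hν, mul_one, Real.norm_of_nonneg (by positivity)]
    exact (div_le_one (by positivity)).2 (by linarith [n.cast_nonneg (α := ℝ)])
  · have key : ∀ (a : ℝ) (y : E3), ψ (y - x - ⟪y - x, ν⟫ • ν) = ⟪y - x, ν⟫ →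
        ⟪a • ν + y - x, ν⟫ -
          ψ (a • ν + y - x - ⟪a • ν + y - x, ν⟫ • ν) = a := fun a y hy => by
      have h1 : ⟪a • ν + y - x, ν⟫ = a + ⟪y - x, ν⟫ := by
        rw [add_sub_assoc, inner_add_left, real_inner_smul_left, hνν, mul_one]
      have h2 : a • ν + y - x - (a + ⟪y - x, ν⟫) • ν = y - x - ⟪y - x, ν⟫ • ν := by module
      rw [h1, h2, hy, add_sub_cancel_right]
    intro m n hmn
    refine disjoint_left.2 fun w hm hn => hmn ?_
    obtain ⟨_, rfl, y, hy, rfl⟩ := hm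
    obtain ⟨_, rfl, z, hz, hyz⟩ := hn
    have h1 := key (1 / ((m : ℝ) + 1)) y hy
    have h2 := key (1 / ((n : ℝ) + 1)) z hz
    simp only at hyz
    rw [hyz, h1] at h2
    have hm0 : (0 : ℝ) < m + 1 := by positivity
    have hn0 : (0 : ℝ) < n + 1 := by positivity
    field_simp at h2
    exact_mod_cast (add_right_cancel h2).symm
  · exact (isClosed_eq (hψ.comp (by fun_prop)) (by fun_prop)).measurableSet

lemma volume_frontier_eq_zero {Ω : Set E3} (ho : IsOpen Ω) (h : HasLipschitzBoundary Ω) :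
    volume (frontier Ω) = 0 := by
  refine measure_null_of_locally_null _ fun x hx => ?_
  obtain ⟨ν, ψ, K, r, hν, hψ, hr, hgraph⟩ := h x hx
  refine ⟨frontier Ω ∩ Metric.ball x r, inter_mem self_mem_nhdsWithin
    (mem_nhdsWithin_of_mem_nhds (Metric.ball_mem_nhds x hr)),
    measure_mono_null ?_ (volume_graph_eq_zero (x := x) hν hψ.continuous)⟩
  have hmem : ∀ y ∈ Metric.ball x r,
      (y ∈ Ω ↔ ψ (y - x - ⟪y - x, ν⟫ • ν) < ⟪y - x, ν⟫) := fun y hy => by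
    have hv : ⟪y - x - ⟪y - x, ν⟫ • ν, ν⟫ = 0 := by
      rw [inner_sub_left, real_inner_smul_left, real_inner_self_eq_norm_sq, hν]
      ring
    have hy' : x + (y - x - ⟪y - x, ν⟫ • ν) + ⟪y - x, ν⟫ • ν = y := by module
    have := hgraph _ ⟪y - x, ν⟫ hv (by rwa [hy'])
    rwa [hy'] at this
  rintro y ⟨hyf, hyb⟩
  have hyΩ : y ∉ Ω := by
    rw [ho.frontier_eq] at hyf
    exact hyf.2
  refine le_antisymm ?_ (not_lt.1 fun hlt => hyΩ ((hmem y hyb).2 hlt))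
  by_contra! hlt
  have hopen : {z : E3 | ⟪z - x, ν⟫ < ψ (z - x - ⟪z - x, ν⟫ • ν)} ∈ 𝓝 y :=
    (isOpen_lt (by fun_prop) (hψ.continuous.comp (by fun_prop))).mem_nhds hlt
  obtain ⟨z, ⟨hz1, hz2⟩, hzΩ⟩ := mem_closure_iff_nhds.1 (frontier_subset_closure hyf) _
    (inter_mem hopen (Metric.isOpen_ball.mem_nhds hyb))
  exact lt_asymm hz1 ((hmem z hz2).1 hzΩ)

section Minimizer

variable {P M : Set E3}

lemma newtonDiff_neg_null_of_minimizer (hP : volume P ≠ ⊤) (hadm : Adm P M)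
    (hmin : ∀ A, Adm P A → energy P M ≤ energy P A) :
    volume (M ∩ {x | newtonDiff P M x < 0}) = 0 := by
  have hM : volume M ≠ ⊤ := hadm.2.2.ne
  have hc := continuous_newtonDiff hP hM
  refine volume_eq_zero_of_first_variation (ψ := fun x => -newtonDiff P M x) hc.neg
    (hadm.1.inter (isOpen_lt hc continuous_const).measurableSet) (fun x hx => neg_pos.2 hx.2)
    fun B hBD hBm hB _ => ?_
  have hBM : B ⊆ M := hBD.trans inter_subset_left
  have hM' : volume (M \ B) ≠ ⊤ := ((measure_mono sdiff_subset).trans_lt hM.lt_top).ne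
  have hE := energy_union hP hM' hB disjoint_sdiff_left hBm
  rw [sdiff_union_of_subset hBM] at hE
  have hle := hmin (M \ B) ⟨hadm.1.diff hBm,
    measure_mono_null (inter_subset_inter_right _ sdiff_subset) hadm.2.1, hM'.lt_top⟩
  have hsplit : ∫ x in B, newtonR M x =
      (∫ x in B, newtonR (M \ B) x) + ∫ x in B, newtonR B x := by
    rw [← integral_add (integrableOn_newtonR hM' hB) (integrableOn_newtonR hB hB)]
    simp_rw [← newtonR_union disjoint_sdiff_left hBm hM' hB, sdiff_union_of_subset hBM]
  simp_rw [newtonDiff]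
  rw [integral_neg, integral_sub (integrableOn_newtonR hP hB) (integrableOn_newtonR hM hB)]
  linarith

lemma newtonDiff_pos_null_of_minimizer (hP : volume P ≠ ⊤) (hPm : MeasurableSet P)
    (hadm : Adm P M) (hmin : ∀ A, Adm P A → energy P M ≤ energy P A) :
    volume ({x | 0 < newtonDiff P M x} \ (P ∪ M)) = 0 := by
  have hM : volume M ≠ ⊤ := hadm.2.2.ne
  have hc := continuous_newtonDiff hP hM
  refine volume_eq_zero_of_first_variation hc
    ((isOpen_lt continuous_const hc).measurableSet.diff (hPm.union hadm.1)) (fun x hx => hx.1)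
    fun B hBD hBm hB _ => ?_
  have hd : Disjoint M B :=
    disjoint_right.2 fun x hx hxM => (hBD hx).2 (Or.inr hxM)
  have hPB : P ∩ B = ∅ :=
    disjoint_iff_inter_eq_empty.1 (disjoint_right.2 fun x hx hxP => (hBD hx).2 (Or.inl hxP))
  have hE := energy_union hP hM hB hd hBm
  have hle := hmin (M ∪ B) ⟨hadm.1.union hBm,
    by rw [inter_union_distrib_left, hPB, union_empty]; exact hadm.2.1,
    measure_union_lt_top hM.lt_top hB.lt_top⟩
  simp_rw [newtonDiff]
  rw [integral_sub (integrableOn_newtonR hP hB) (integrableOn_newtonR hM hB)]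
  linarith

end Minimizer

end Helpers

/-- **Theorem 2.3** (second part): the minimizer has the open representative
`{φ > 0} \ closure Ω⁺`, and under an interior ball condition the potential is
strictly positive on the closure of `Ω⁺`. -/
theorem minimizer_open_representative
    (Ωp : Set E3) (ho : IsOpen Ωp) (hb : Bornology.IsBounded Ωp)
    (hlip : HasLipschitzBoundary Ωp)
    (Ωm : Set E3) (hadm : Adm Ωp Ωm)
    (hmin : ∀ A, Adm Ωp A → energy Ωp Ωm ≤ energy Ωp A) :
    IsOpen ({x | 0 < potential Ωp Ωm x} \ closure Ωp) ∧
    volume (symmDiff ({x | 0 < potential Ωp Ωm x} \ closure Ωp) Ωm) = 0 ∧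
    (InteriorBallCondition Ωp → ∀ x ∈ closure Ωp, 0 < potential Ωp Ωm x) := by
  have hP : volume Ωp ≠ ⊤ := hb.measure_lt_top.ne
  have hM : volume Ωm ≠ ⊤ := hadm.2.2.ne
  have hPm := ho.measurableSet
  have hpot : potential Ωp Ωm = newtonDiff Ωp Ωm :=
    funext (potential_eq hPm hP hadm.1 hM)
  rw [hpot]
  have hc := continuous_newtonDiff hP hM
  have hneg := newtonDiff_neg_null_of_minimizer hP hadm hmin
  have hnn := newtonDiff_nonneg hP hM hneg
  have hzero := volume_inter_newtonDiff_eq_zero hP hM hnn hadm.1 hadm.2.1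
  refine ⟨(isOpen_lt continuous_const hc).sdiff isClosed_closure, ?_, fun hball x hx => ?_⟩
  · refine measure_mono_null ?_ (measure_union_null
      (measure_union_null (newtonDiff_pos_null_of_minimizer hP hPm hadm hmin) hzero)
      (measure_union_null hadm.2.1 (volume_frontier_eq_zero ho hlip)))
    rintro x (⟨⟨hx, hxP⟩, hxM⟩ | ⟨hxM, hx⟩)
    · exact Or.inl (Or.inl ⟨hx, fun h => h.elim (fun h => hxP (subset_closure h)) hxM⟩)
    · by_cases hxP : x ∈ closure Ωp
      · by_cases hxo : x ∈ Ωp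
        · exact Or.inr (Or.inl ⟨hxo, hxM⟩)
        · exact Or.inr (Or.inr (by rw [ho.frontier_eq]; exact ⟨hxP, hxo⟩))
      · exact Or.inl (Or.inr ⟨hxM, le_antisymm (not_lt.1 fun h => hx ⟨h, hxP⟩) (hnn x)⟩)
  · by_cases hxo : x ∈ Ωp
    · obtain ⟨ρ, hρ, hρP⟩ := Metric.isOpen_iff.1 ho x hxo
      refine lt_of_lt_of_le ?_
        (le_newtonDiff_of_ball_subset hP hM hnn hPm hadm.2.1 hρ hρP x)
      rw [sub_self, norm_zero, zero_pow two_ne_zero, sub_zero]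
      positivity
    · obtain ⟨c, ρ, hρ, hcP, hxc⟩ := hball x (by rw [ho.frontier_eq]; exact ⟨hx, hxo⟩)
      exact newtonDiff_pos_of_mem_sphere hP hM hnn hPm hadm.2.1 hρ hcP hxc
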